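/- Let M be a complex manifold, S a closed subset, U_0 = M ∖ S, U_1 an open neighborhood of S, and 𝒰 = {U_0, U_1}. Then there is a long exact sequence ⋯ → H^{p-1,q-1}_A(𝒰) → H^{p-1,q-1}_A(U_0) →^{δ*} H^{p,q}_{BC}(𝒰, U_0) →^{j*} H^{p,q}_{BC}(𝒰) →^{i*} H^{p,q}_{BC}(U_0) → H^{(p,q)+1}(𝒰, U_0) → H^{(p,q)+1}(𝒰) → H^{(p,q)+1}(U_0) → H^{p+1,q+1}_A(𝒰, U_0) → ⋯ relating the Čech-Aeppli, relative Bott-Chern, Čech-Bott-Chern and third cohomologies. -/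

import Mathlib

/-!
Statement 7 (Theorem 3.12 of the paper).  Let `M` be a complex manifold, `S` a closed
subset, `U₀ = M ∖ S`, `U₁` an open neighborhood of `S`, `𝒰 = {U₀, U₁}`.  Then there is a
long exact sequence
`⋯ → H^{p-1,q-1}_A(𝒰) → H^{p-1,q-1}_A(U₀) → H^{p,q}_{BC}(𝒰,U₀) → H^{p,q}_{BC}(𝒰) →
H^{p,q}_{BC}(U₀) → H^{(p,q)+1}(𝒰,U₀) → H^{(p,q)+1}(𝒰) → H^{(p,q)+1}(U₀) →
H^{p+1,q+1}_A(𝒰,U₀) → ⋯`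
relating the Čech–Aeppli, relative Bott–Chern, Čech–Bott–Chern and third cohomologies.

All cohomologies arise from the single mixed complex
`⋯ → E^{(p-2,q-2)+1} → E^{p-1,q-1} → E^{p,q} → E^{(p,q)+1} → E^{p+1,q+1} → ⋯`
(with differentials `∂̄+∂`, `∂̄∂`, `d`); the sheaves of forms are modelled abstractly by
`DoubleFormSheaf`, and the Čech and relative groups are built on the cochain groups
`E^{p,q}_{BC}(𝒰)`, `E^{p,q}_{A}(𝒰)`, `E^{(p,q)+1}(𝒰)` (`TBC`, `TA`, `TT`) and their
relative versions (`RBC`, `RA`, `RT`, obtained by setting the `U₀`-component to zero).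
The maps of the sequence are characterized on classes of cocycles by the usual formulas
(`i`-type: project to the `U₀`-component; `j`-type: include with vanishing `U₀`-component;
`δ`-type: `[θ] ↦ [(0, -θ)]`).
-/

open TopologicalSpace

universe u

section LinearHelpers

variable {A B C S : Type u} [AddCommGroup A] [Module ℂ A] [AddCommGroup B] [Module ℂ B]
  [AddCommGroup C] [Module ℂ C] [AddCommGroup S] [Module ℂ S]

/-- a linear map into a triple product -/
def lmTri (f : S →ₗ[ℂ] A) (g : S →ₗ[ℂ] B) (h : S →ₗ[ℂ] C) : S →ₗ[ℂ] A × B × C :=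
  LinearMap.prod f (LinearMap.prod g h)

/-- first projection of a triple product -/
def pA : A × B × C →ₗ[ℂ] A := LinearMap.fst ℂ A (B × C)

/-- second projection of a triple product -/
def pB : A × B × C →ₗ[ℂ] B := (LinearMap.fst ℂ B C).comp (LinearMap.snd ℂ A (B × C))

/-- third projection of a triple product -/
def pC : A × B × C →ₗ[ℂ] C := (LinearMap.snd ℂ B C).comp (LinearMap.snd ℂ A (B × C))

/-- first projection of a pair -/
def qA : A × B →ₗ[ℂ] A := LinearMap.fst ℂ A B

/-- second projection of a pair -/
def qB : A × B →ₗ[ℂ] B := LinearMap.snd ℂ A B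

end LinearHelpers

/-- The cohomology of a pair of composable linear maps `f : A → B`, `g : B → C` with
`g ∘ f = 0` (in the situations where this is used):  `Ker g / Im f`. -/
abbrev cohomOf {A B C : Type u} [AddCommGroup A] [Module ℂ A] [AddCommGroup B] [Module ℂ B]
    [AddCommGroup C] [Module ℂ C] (f : A →ₗ[ℂ] B) (g : B →ₗ[ℂ] C) : Type u :=
  ↥(LinearMap.ker g) ⧸ (Submodule.comap (LinearMap.ker g).subtype (LinearMap.range f))

/-- The cohomology class of a cocycle. -/
def cohomMk {A B C : Type u} [AddCommGroup A] [Module ℂ A] [AddCommGroup B] [Module ℂ B]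
    [AddCommGroup C] [Module ℂ C] (f : A →ₗ[ℂ] B) (g : B →ₗ[ℂ] C) (b : B) (hb : g b = 0) :
    cohomOf f g :=
  Submodule.Quotient.mk ⟨b, LinearMap.mem_ker.mpr hb⟩

/-- The sheaves `E^{p,q}` of `C^∞` differential forms of type `(p,q)` on (the underlying
topological space of) a complex manifold, encoded abstractly: a presheaf of `ℂ`-modules
`E p q U` with the differentials `∂` (`del`) and `∂̄` (`dbar`), satisfying `∂² = ∂̄² = 0`,
`∂∂̄ + ∂̄∂ = 0`, compatibility with restrictions, the sheaf gluing condition for pairs of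
open sets, and the softness property coming from `C^∞` partitions of unity (`pou`). -/
structure DoubleFormSheaf (X : Type u) [TopologicalSpace X] : Type (u + 1) where
  /-- the `ℂ`-module of `(p,q)`-forms on an open set `U` -/
  E : ℤ → ℤ → Opens X → ModuleCat.{u} ℂ
  /-- restriction of forms -/
  res : ∀ (p q : ℤ) ⦃U V : Opens X⦄, U ≤ V → ((E p q V) →ₗ[ℂ] (E p q U))
  res_refl : ∀ (p q : ℤ) (U : Opens X) (x : E p q U), res p q (le_refl U) x = x
  res_res : ∀ (p q : ℤ) ⦃U V W : Opens X⦄ (hUV : U ≤ V) (hVW : V ≤ W) (x : E p q W),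
      res p q hUV (res p q hVW x) = res p q (hUV.trans hVW) x
  /-- the differential `∂` -/
  del : ∀ (p q : ℤ) (U : Opens X), (E p q U) →ₗ[ℂ] (E (p + 1) q U)
  /-- the differential `∂̄` -/
  dbar : ∀ (p q : ℤ) (U : Opens X), (E p q U) →ₗ[ℂ] (E p (q + 1) U)
  del_del : ∀ (p q : ℤ) (U : Opens X) (x : E p q U), del (p + 1) q U (del p q U x) = 0
  dbar_dbar : ∀ (p q : ℤ) (U : Opens X) (x : E p q U), dbar p (q + 1) U (dbar p q U x) = 0
  del_dbar : ∀ (p q : ℤ) (U : Opens X) (x : E p q U),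
      del p (q + 1) U (dbar p q U x) + dbar (p + 1) q U (del p q U x) = 0
  res_del : ∀ (p q : ℤ) ⦃U V : Opens X⦄ (h : U ≤ V) (x : E p q V),
      del p q U (res p q h x) = res (p + 1) q h (del p q V x)
  res_dbar : ∀ (p q : ℤ) ⦃U V : Opens X⦄ (h : U ≤ V) (x : E p q V),
      dbar p q U (res p q h x) = res p (q + 1) h (dbar p q V x)
  /-- sheaf condition: forms agreeing on the overlap glue -/
  glue : ∀ (p q : ℤ) ⦃U V : Opens X⦄ (a : E p q U) (b : E p q V),
      res p q inf_le_left a = res p q inf_le_right b →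
      ∃! c : E p q (U ⊔ V), res p q le_sup_left c = a ∧ res p q le_sup_right c = b
  /-- softness coming from `C^∞` partitions of unity subordinate to a two-set open cover:
  "multiplication by `ρ₁` (resp. `ρ₀`) followed by extension by zero" operators. -/
  pou : ∀ ⦃U V : Opens X⦄, U ⊔ V = ⊤ →
      ∃ (z₀ : ∀ p q : ℤ, ((E p q (U ⊓ V)) →ₗ[ℂ] (E p q U)))
        (z₁ : ∀ p q : ℤ, ((E p q (U ⊓ V)) →ₗ[ℂ] (E p q V))),
        ∀ (p q : ℤ) (x : E p q (U ⊓ V)),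
          res p q inf_le_left (z₀ p q x) + res p q inf_le_right (z₁ p q x) = x

namespace DoubleFormSheaf

variable {X : Type u} [TopologicalSpace X] (F : DoubleFormSheaf X)

/-- identification of the modules of forms in equal bidegrees -/
def cast (U : Opens X) :
    ∀ {p q p' q' : ℤ}, p = p' → q = q' → ((F.E p q U) →ₗ[ℂ] (F.E p' q' U))
  | _, _, _, _, rfl, rfl => LinearMap.id

section Cech

variable (U₀ U₁ : Opens X)

/-- Čech–Bott–Chern cochains `E^{p,q}_{BC}(𝒰) = E^{p,q}(U₀) ⊕ E^{p,q}(U₁) ⊕ E^{p-1,q-1}(U₀₁)` -/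
abbrev TBC (p q : ℤ) : Type u :=
  ↥(F.E p q U₀) × ↥(F.E p q U₁) × ↥(F.E (p - 1) (q - 1) (U₀ ⊓ U₁))

/-- Čech–Aeppli cochains
`E^{p,q}_{A}(𝒰) = E^{p,q}(U₀) ⊕ E^{p,q}(U₁) ⊕ E^{(p-1,q-1)+1}(U₀₁)`,
`E^{(p-1,q-1)+1} = E^{p,q-1} ⊕ E^{p-1,q}` -/
abbrev TA (p q : ℤ) : Type u :=
  ↥(F.E p q U₀) × ↥(F.E p q U₁) ×
    (↥(F.E p (q - 1) (U₀ ⊓ U₁)) × ↥(F.E (p - 1) q (U₀ ⊓ U₁)))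

/-- Čech cochains of the third type
`E^{(p,q)+1}(𝒰) = E^{(p,q)+1}(U₀) ⊕ E^{(p,q)+1}(U₁) ⊕ E^{p,q}(U₀₁)`,
`E^{(p,q)+1} = E^{p+1,q} ⊕ E^{p,q+1}` -/
abbrev TT (p q : ℤ) : Type u :=
  (↥(F.E (p + 1) q U₀) × ↥(F.E p (q + 1) U₀)) ×
    (↥(F.E (p + 1) q U₁) × ↥(F.E p (q + 1) U₁)) × ↥(F.E p q (U₀ ⊓ U₁))

/-- Čech–Dolbeault cochains `E^{p,q}(𝒰) = E^{p,q}(U₀) ⊕ E^{p,q}(U₁) ⊕ E^{p,q-1}(U₀₁)` -/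
abbrev TD (p q : ℤ) : Type u :=
  ↥(F.E p q U₀) × ↥(F.E p q U₁) × ↥(F.E p (q - 1) (U₀ ⊓ U₁))

/-- relative Čech–Bott–Chern cochains `E^{p,q}_{BC}(𝒰, U₀) = E^{p,q}(U₁) ⊕ E^{p-1,q-1}(U₀₁)` -/
abbrev RBC (p q : ℤ) : Type u :=
  ↥(F.E p q U₁) × ↥(F.E (p - 1) (q - 1) (U₀ ⊓ U₁))

/-- relative Čech–Aeppli cochains `E^{p,q}_{A}(𝒰, U₀) = E^{p,q}(U₁) ⊕ E^{(p-1,q-1)+1}(U₀₁)` -/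
abbrev RA (p q : ℤ) : Type u :=
  ↥(F.E p q U₁) × (↥(F.E p (q - 1) (U₀ ⊓ U₁)) × ↥(F.E (p - 1) q (U₀ ⊓ U₁)))

/-- relative Čech cochains of the third type `E^{(p,q)+1}(𝒰, U₀) = E^{(p,q)+1}(U₁) ⊕ E^{p,q}(U₀₁)` -/
abbrev RT (p q : ℤ) : Type u :=
  (↥(F.E (p + 1) q U₁) × ↥(F.E p (q + 1) U₁)) × ↥(F.E p q (U₀ ⊓ U₁))

/-- relative Čech–Dolbeault cochains `E^{p,q}(𝒰, U₀) = E^{p,q}(U₁) ⊕ E^{p,q-1}(U₀₁)` -/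
abbrev RD (p q : ℤ) : Type u :=
  ↥(F.E p q U₁) × ↥(F.E p (q - 1) (U₀ ⊓ U₁))

/-- the Čech differential `E^{p,q}_{BC}(𝒰) → E^{(p,q)+1}(𝒰)`,
`σ ↦ ((∂σ₀, ∂̄σ₀), (∂σ₁, ∂̄σ₁), σ₁ - σ₀ - ∂̄∂σ₀₁)` (i.e. `σ ↦ (dσ₀, dσ₁, σ₁ - σ₀ - ∂̄∂σ₀₁)`) -/
def DtoTT (p q : ℤ) : TBC F U₀ U₁ p q →ₗ[ℂ] TT F U₀ U₁ p q :=
  lmTri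
    (LinearMap.prod ((F.del p q U₀).comp pA) ((F.dbar p q U₀).comp pA))
    (LinearMap.prod ((F.del p q U₁).comp pB) ((F.dbar p q U₁).comp pB))
    (((F.res p q inf_le_right).comp pB - (F.res p q inf_le_left).comp pA) -
      ((F.cast (U₀ ⊓ U₁) (show p - 1 + 1 = p by ring) (show q - 1 + 1 = q by ring)).comp
        ((F.dbar (p - 1 + 1) (q - 1) (U₀ ⊓ U₁)).comp
          ((F.del (p - 1) (q - 1) (U₀ ⊓ U₁)).comp pC))))

/-- the Čech differential `E^{(p,q)+1}(𝒰) → E^{p+1,q+1}_{A?}(𝒰)`; more precisely the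
differential `E^{(p,q)+1}(𝒰) → E^{p+1,q+1}(𝒰)`-component of the mixed complex, landing in
the Aeppli-type cochains `E^{p+1,q+1}_{A}(𝒰)`:
`((α₀,β₀), (α₁,β₁), γ) ↦ (∂̄α₀ + ∂β₀, ∂̄α₁ + ∂β₁, (α₁ - α₀ - ∂γ, β₁ - β₀ - ∂̄γ))` -/
def DtoTA (p q : ℤ) : TT F U₀ U₁ p q →ₗ[ℂ] TA F U₀ U₁ (p + 1) (q + 1) :=
  lmTri
    (((F.dbar (p + 1) q U₀).comp (qA.comp pA)) + ((F.del p (q + 1) U₀).comp (qB.comp pA)))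
    (((F.dbar (p + 1) q U₁).comp (qA.comp pB)) + ((F.del p (q + 1) U₁).comp (qB.comp pB)))
    (LinearMap.prod
      ((F.cast (U₀ ⊓ U₁) rfl (show q = q + 1 - 1 by ring)).comp
        (((F.res (p + 1) q inf_le_right).comp (qA.comp pB) -
            (F.res (p + 1) q inf_le_left).comp (qA.comp pA)) -
          ((F.del p q (U₀ ⊓ U₁)).comp pC)))
      ((F.cast (U₀ ⊓ U₁) (show p = p + 1 - 1 by ring) rfl).comp
        (((F.res p (q + 1) inf_le_right).comp (qB.comp pB) -
            (F.res p (q + 1) inf_le_left).comp (qB.comp pA)) -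
          ((F.dbar p q (U₀ ⊓ U₁)).comp pC))))

/-- the Čech differential `E^{p,q}_{A}(𝒰) → E^{p+1,q+1}_{BC}(𝒰)`:
`(ξ₀, ξ₁, (η₁, η₂)) ↦ (∂̄∂ξ₀, ∂̄∂ξ₁, ξ₁ - ξ₀ - ∂̄η₁ - ∂η₂)` -/
def DtoTBC (p q : ℤ) : TA F U₀ U₁ p q →ₗ[ℂ] TBC F U₀ U₁ (p + 1) (q + 1) :=
  lmTri
    ((F.dbar (p + 1) q U₀).comp ((F.del p q U₀).comp pA))
    ((F.dbar (p + 1) q U₁).comp ((F.del p q U₁).comp pB))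
    ((F.cast (U₀ ⊓ U₁) (show p = p + 1 - 1 by ring) (show q = q + 1 - 1 by ring)).comp
      ((((F.res p q inf_le_right).comp pB - (F.res p q inf_le_left).comp pA) -
          ((F.cast (U₀ ⊓ U₁) rfl (show q - 1 + 1 = q by ring)).comp
            ((F.dbar p (q - 1) (U₀ ⊓ U₁)).comp (qA.comp pC)))) -
        ((F.cast (U₀ ⊓ U₁) (show p - 1 + 1 = p by ring) rfl).comp
          ((F.del (p - 1) q (U₀ ⊓ U₁)).comp (qB.comp pC)))))

/-- the Čech–Dolbeault differential `∂̄ϑ σ = (∂̄σ₀, ∂̄σ₁, σ₁ - σ₀ - ∂̄σ₀₁)` -/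
def DD (p q : ℤ) : TD F U₀ U₁ p q →ₗ[ℂ] TD F U₀ U₁ p (q + 1) :=
  lmTri
    ((F.dbar p q U₀).comp pA)
    ((F.dbar p q U₁).comp pB)
    (((F.cast (U₀ ⊓ U₁) rfl (show q = q + 1 - 1 by ring)).comp
        ((F.res p q inf_le_right).comp pB - (F.res p q inf_le_left).comp pA)) -
      ((F.cast (U₀ ⊓ U₁) rfl (show q - 1 + 1 = q + 1 - 1 by ring)).comp
        ((F.dbar p (q - 1) (U₀ ⊓ U₁)).comp pC)))

/-- the relative Čech differential `E^{p,q}_{BC}(𝒰,U₀) → E^{(p,q)+1}(𝒰,U₀)` -/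
def RtoTT (p q : ℤ) : RBC F U₀ U₁ p q →ₗ[ℂ] RT F U₀ U₁ p q :=
  LinearMap.prod
    (LinearMap.prod ((F.del p q U₁).comp qA) ((F.dbar p q U₁).comp qA))
    (((F.res p q inf_le_right).comp qA) -
      ((F.cast (U₀ ⊓ U₁) (show p - 1 + 1 = p by ring) (show q - 1 + 1 = q by ring)).comp
        ((F.dbar (p - 1 + 1) (q - 1) (U₀ ⊓ U₁)).comp
          ((F.del (p - 1) (q - 1) (U₀ ⊓ U₁)).comp qB))))

/-- the relative Čech differential `E^{(p,q)+1}(𝒰,U₀) → E^{p+1,q+1}_{A}(𝒰,U₀)` -/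
def RtoTA (p q : ℤ) : RT F U₀ U₁ p q →ₗ[ℂ] RA F U₀ U₁ (p + 1) (q + 1) :=
  LinearMap.prod
    (((F.dbar (p + 1) q U₁).comp (qA.comp qA)) + ((F.del p (q + 1) U₁).comp (qB.comp qA)))
    (LinearMap.prod
      ((F.cast (U₀ ⊓ U₁) rfl (show q = q + 1 - 1 by ring)).comp
        (((F.res (p + 1) q inf_le_right).comp (qA.comp qA)) -
          ((F.del p q (U₀ ⊓ U₁)).comp qB)))
      ((F.cast (U₀ ⊓ U₁) (show p = p + 1 - 1 by ring) rfl).comp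
        (((F.res p (q + 1) inf_le_right).comp (qB.comp qA)) -
          ((F.dbar p q (U₀ ⊓ U₁)).comp qB))))

/-- the relative Čech differential `E^{p,q}_{A}(𝒰,U₀) → E^{p+1,q+1}_{BC}(𝒰,U₀)` -/
def RtoTBC (p q : ℤ) : RA F U₀ U₁ p q →ₗ[ℂ] RBC F U₀ U₁ (p + 1) (q + 1) :=
  LinearMap.prod
    ((F.dbar (p + 1) q U₁).comp ((F.del p q U₁).comp qA))
    ((F.cast (U₀ ⊓ U₁) (show p = p + 1 - 1 by ring) (show q = q + 1 - 1 by ring)).comp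
      ((((F.res p q inf_le_right).comp qA) -
          ((F.cast (U₀ ⊓ U₁) rfl (show q - 1 + 1 = q by ring)).comp
            ((F.dbar p (q - 1) (U₀ ⊓ U₁)).comp (qA.comp qB)))) -
        ((F.cast (U₀ ⊓ U₁) (show p - 1 + 1 = p by ring) rfl).comp
          ((F.del (p - 1) q (U₀ ⊓ U₁)).comp (qB.comp qB)))))

/-- the relative Čech–Dolbeault differential -/
def DrD (p q : ℤ) : RD F U₀ U₁ p q →ₗ[ℂ] RD F U₀ U₁ p (q + 1) :=
  LinearMap.prod
    ((F.dbar p q U₁).comp qA)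
    (((F.cast (U₀ ⊓ U₁) rfl (show q = q + 1 - 1 by ring)).comp
        ((F.res p q inf_le_right).comp qA)) -
      ((F.cast (U₀ ⊓ U₁) rfl (show q - 1 + 1 = q + 1 - 1 by ring)).comp
        ((F.dbar p (q - 1) (U₀ ⊓ U₁)).comp qB)))

/-- identification of Čech–Bott–Chern cochains in equal bidegrees -/
def castTBC {p q p' q' : ℤ} (hp : p = p') (hq : q = q') :
    TBC F U₀ U₁ p q →ₗ[ℂ] TBC F U₀ U₁ p' q' :=
  lmTri ((F.cast U₀ hp hq).comp pA) ((F.cast U₁ hp hq).comp pB)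
    ((F.cast _ (by rw [hp]) (by rw [hq])).comp pC)

/-- identification of Čech–Aeppli cochains in equal bidegrees -/
def castTA {p q p' q' : ℤ} (hp : p = p') (hq : q = q') :
    TA F U₀ U₁ p q →ₗ[ℂ] TA F U₀ U₁ p' q' :=
  lmTri ((F.cast U₀ hp hq).comp pA) ((F.cast U₁ hp hq).comp pB)
    (LinearMap.prod ((F.cast _ hp (by rw [hq])).comp (qA.comp pC))
      ((F.cast _ (by rw [hp]) hq).comp (qB.comp pC)))

/-- identification of Čech–Dolbeault cochains in equal bidegrees -/
def castTD {p q p' q' : ℤ} (hp : p = p') (hq : q = q') :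
    TD F U₀ U₁ p q →ₗ[ℂ] TD F U₀ U₁ p' q' :=
  lmTri ((F.cast U₀ hp hq).comp pA) ((F.cast U₁ hp hq).comp pB)
    ((F.cast _ hp (by rw [hq])).comp pC)

/-- identification of relative Čech–Bott–Chern cochains in equal bidegrees -/
def castRBC {p q p' q' : ℤ} (hp : p = p') (hq : q = q') :
    RBC F U₀ U₁ p q →ₗ[ℂ] RBC F U₀ U₁ p' q' :=
  LinearMap.prod ((F.cast U₁ hp hq).comp qA)
    ((F.cast _ (by rw [hp]) (by rw [hq])).comp qB)

/-- identification of relative Čech–Aeppli cochains in equal bidegrees -/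
def castRA {p q p' q' : ℤ} (hp : p = p') (hq : q = q') :
    RA F U₀ U₁ p q →ₗ[ℂ] RA F U₀ U₁ p' q' :=
  LinearMap.prod ((F.cast U₁ hp hq).comp qA)
    (LinearMap.prod ((F.cast _ hp (by rw [hq])).comp (qA.comp qB))
      ((F.cast _ (by rw [hp]) hq).comp (qB.comp qB)))

/-- identification of relative Čech–Dolbeault cochains in equal bidegrees -/
def castRD {p q p' q' : ℤ} (hp : p = p') (hq : q = q') :
    RD F U₀ U₁ p q →ₗ[ℂ] RD F U₀ U₁ p' q' :=
  LinearMap.prod ((F.cast U₁ hp hq).comp qA)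
    ((F.cast _ hp (by rw [hq])).comp qB)

/-- the Čech–Bott–Chern cohomology `H^{p,q}_{BC}(𝒰)` -/
abbrev HBCcech (p q : ℤ) : Type u :=
  cohomOf
    ((castTBC F U₀ U₁ (show p - 1 + 1 = p by ring) (show q - 1 + 1 = q by ring)).comp
      (DtoTBC F U₀ U₁ (p - 1) (q - 1)))
    (DtoTT F U₀ U₁ p q)

/-- the Čech–Aeppli cohomology `H^{p,q}_{A}(𝒰)` -/
abbrev HAcech (p q : ℤ) : Type u :=
  cohomOf
    ((castTA F U₀ U₁ (show p - 1 + 1 = p by ring) (show q - 1 + 1 = q by ring)).comp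
      (DtoTA F U₀ U₁ (p - 1) (q - 1)))
    (DtoTBC F U₀ U₁ p q)

/-- the Čech cohomology of the third type `H^{(p,q)+1}(𝒰)` -/
abbrev HTcech (p q : ℤ) : Type u :=
  cohomOf (DtoTT F U₀ U₁ p q) (DtoTA F U₀ U₁ p q)

/-- the Čech–Dolbeault cohomology `H^{p,q}_{∂̄ϑ}(𝒰)` -/
abbrev HDcech (p q : ℤ) : Type u :=
  cohomOf ((castTD F U₀ U₁ rfl (show q - 1 + 1 = q by ring)).comp (DD F U₀ U₁ p (q - 1)))
    (DD F U₀ U₁ p q)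

/-- the relative Bott–Chern cohomology `H^{p,q}_{BC}(𝒰, U₀)` -/
abbrev HBCrel (p q : ℤ) : Type u :=
  cohomOf
    ((castRBC F U₀ U₁ (show p - 1 + 1 = p by ring) (show q - 1 + 1 = q by ring)).comp
      (RtoTBC F U₀ U₁ (p - 1) (q - 1)))
    (RtoTT F U₀ U₁ p q)

/-- the relative Aeppli cohomology `H^{p,q}_{A}(𝒰, U₀)` -/
abbrev HArel (p q : ℤ) : Type u :=
  cohomOf
    ((castRA F U₀ U₁ (show p - 1 + 1 = p by ring) (show q - 1 + 1 = q by ring)).comp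
      (RtoTA F U₀ U₁ (p - 1) (q - 1)))
    (RtoTBC F U₀ U₁ p q)

/-- the relative cohomology of the third type `H^{(p,q)+1}(𝒰, U₀)` -/
abbrev HTrel (p q : ℤ) : Type u :=
  cohomOf (RtoTT F U₀ U₁ p q) (RtoTA F U₀ U₁ p q)

/-- the relative Dolbeault cohomology `H^{p,q}_{∂̄ϑ}(𝒰, U₀)` -/
abbrev HDrel (p q : ℤ) : Type u :=
  cohomOf ((castRD F U₀ U₁ rfl (show q - 1 + 1 = q by ring)).comp (DrD F U₀ U₁ p (q - 1)))
    (DrD F U₀ U₁ p q)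

end Cech

section OpenSet

variable (W : Opens X)

/-- the differential `∂̄ + ∂ : E^{(p-1,q-1)+1}(W) → E^{p,q}(W)`, `(η₁, η₂) ↦ ∂̄η₁ + ∂η₂` -/
def plusW (p q : ℤ) :
    (↥(F.E p (q - 1) W) × ↥(F.E (p - 1) q W)) →ₗ[ℂ] ↥(F.E p q W) :=
  ((F.cast W rfl (show q - 1 + 1 = q by ring)).comp ((F.dbar p (q - 1) W).comp qA)) +
    ((F.cast W (show p - 1 + 1 = p by ring) rfl).comp ((F.del (p - 1) q W).comp qB))

/-- the differential `∂̄∂ : E^{p,q}(W) → E^{p+1,q+1}(W)` -/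
def ddbarW (p q : ℤ) : ↥(F.E p q W) →ₗ[ℂ] ↥(F.E (p + 1) (q + 1) W) :=
  (F.dbar (p + 1) q W).comp (F.del p q W)

/-- the differential `d : E^{p,q}(W) → E^{(p,q)+1}(W)`, `ω ↦ (∂ω, ∂̄ω)` -/
def dfullW (p q : ℤ) :
    ↥(F.E p q W) →ₗ[ℂ] (↥(F.E (p + 1) q W) × ↥(F.E p (q + 1) W)) :=
  LinearMap.prod (F.del p q W) (F.dbar p q W)

/-- the differential `∂̄ + ∂ : E^{(p,q)+1}(W) → E^{p+1,q+1}(W)`, `(α, β) ↦ ∂̄α + ∂β` -/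
def plusTW (p q : ℤ) :
    (↥(F.E (p + 1) q W) × ↥(F.E p (q + 1) W)) →ₗ[ℂ] ↥(F.E (p + 1) (q + 1) W) :=
  ((F.dbar (p + 1) q W).comp qA) + ((F.del p (q + 1) W).comp qB)

/-- the Bott–Chern cohomology `H^{p,q}_{BC}(W)` of an open set `W` -/
abbrev HBCopen (p q : ℤ) : Type u :=
  cohomOf
    ((F.cast W (show p - 1 + 1 = p by ring) (show q - 1 + 1 = q by ring)).comp
      (ddbarW F W (p - 1) (q - 1)))
    (dfullW F W p q)

/-- the Aeppli cohomology `H^{p,q}_{A}(W)` of an open set `W` -/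
abbrev HAopen (p q : ℤ) : Type u :=
  cohomOf (plusW F W p q) (ddbarW F W p q)

/-- the cohomology of the third type `H^{(p,q)+1}(W)` of an open set `W` -/
abbrev HTopen (p q : ℤ) : Type u :=
  cohomOf (dfullW F W p q) (plusTW F W p q)

/-- the Dolbeault cohomology `H^{p,q}_{∂̄}(W)` of an open set `W` -/
abbrev HDopen (p q : ℤ) : Type u :=
  cohomOf ((F.cast W rfl (show q - 1 + 1 = q by ring)).comp (F.dbar p (q - 1) W))
    (F.dbar p q W)

end OpenSet

section Tilde

variable (U₀ U₁ : Opens X)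

/-- the map `ω ↦ (ω|_{U₀}, ω|_{U₁}, 0)` into Čech–Bott–Chern cochains -/
def tBC (p q : ℤ) : ↥(F.E p q ⊤) →ₗ[ℂ] TBC F U₀ U₁ p q :=
  lmTri (F.res p q le_top) (F.res p q le_top) 0

/-- the map `ω ↦ (ω|_{U₀}, ω|_{U₁}, 0, 0)` into Čech–Aeppli cochains -/
def tA (p q : ℤ) : ↥(F.E p q ⊤) →ₗ[ℂ] TA F U₀ U₁ p q :=
  lmTri (F.res p q le_top) (F.res p q le_top) 0

/-- the map `ω ↦ (ω|_{U₀}, ω|_{U₁}, 0)` into Čech–Dolbeault cochains -/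
def tD (p q : ℤ) : ↥(F.E p q ⊤) →ₗ[ℂ] TD F U₀ U₁ p q :=
  lmTri (F.res p q le_top) (F.res p q le_top) 0

end Tilde

end DoubleFormSheaf

open DoubleFormSheaf

section CohomologyOfPairs

variable {A B C A' B' C' A'' B'' C'' : Type u}
  [AddCommGroup A] [Module ℂ A] [AddCommGroup B] [Module ℂ B] [AddCommGroup C] [Module ℂ C]
  [AddCommGroup A'] [Module ℂ A'] [AddCommGroup B'] [Module ℂ B'] [AddCommGroup C'] [Module ℂ C']
  [AddCommGroup A''] [Module ℂ A''] [AddCommGroup B''] [Module ℂ B'']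
  [AddCommGroup C''] [Module ℂ C'']

/-- The map induced on cohomology by a linear map preserving cocycles and coboundaries. -/
def cohomMap (f : A →ₗ[ℂ] B) (g : B →ₗ[ℂ] C) (f' : A' →ₗ[ℂ] B') (g' : B' →ₗ[ℂ] C')
    (a : B →ₗ[ℂ] B') (hg : ∀ x, g x = 0 → g' (a x) = 0) (hf : ∀ x, ∃ y, f' y = a (f x)) :
    cohomOf f g →ₗ[ℂ] cohomOf f' g' :=
  Submodule.mapQ _ _ (a.restrict (p := LinearMap.ker g) (q := LinearMap.ker g') hg) (by
    rintro ⟨x, hx⟩ ⟨w, hw⟩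
    obtain ⟨y, hy⟩ := hf w
    exact ⟨y, hy.trans (congrArg a hw)⟩)

theorem cohomMk_eq_cohomMk_iff {f : A →ₗ[ℂ] B} {g : B →ₗ[ℂ] C} {x y : B} (hx : g x = 0)
    (hy : g y = 0) : cohomMk f g x hx = cohomMk f g y hy ↔ ∃ w, f w = x - y :=
  Submodule.Quotient.eq _

theorem cohomMk_eq_zero_iff {f : A →ₗ[ℂ] B} {g : B →ₗ[ℂ] C} {x : B} (hx : g x = 0) :
    cohomMk f g x hx = 0 ↔ ∃ w, f w = x :=
  Submodule.Quotient.mk_eq_zero _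

theorem cohomMk_surjective {f : A →ₗ[ℂ] B} {g : B →ₗ[ℂ] C} (c : cohomOf f g) :
    ∃ x hx, cohomMk f g x hx = c := by
  obtain ⟨⟨x, hx⟩, rfl⟩ := Submodule.Quotient.mk_surjective _ c
  exact ⟨x, hx, rfl⟩

theorem cohomMap_exact_iff {f : A →ₗ[ℂ] B} {g : B →ₗ[ℂ] C} {f' : A' →ₗ[ℂ] B'}
    {g' : B' →ₗ[ℂ] C'} {f'' : A'' →ₗ[ℂ] B''} {g'' : B'' →ₗ[ℂ] C''}
    {a : B →ₗ[ℂ] B'} {b : B' →ₗ[ℂ] B''} (hg hf hg' hf') :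
    Function.Exact (cohomMap f g f' g' a hg hf) (cohomMap f' g' f'' g'' b hg' hf') ↔
      ∀ x, g' x = 0 → ((∃ y, f'' y = b x) ↔ ∃ z, g z = 0 ∧ ∃ w, f' w = x - a z) := by
  have key : ∀ x (hx : g' x = 0),
      (cohomMap f' g' f'' g'' b hg' hf' (cohomMk f' g' x hx) = 0 ↔ ∃ y, f'' y = b x) ∧
      (cohomMk f' g' x hx ∈ Set.range (cohomMap f g f' g' a hg hf) ↔
        ∃ z, g z = 0 ∧ ∃ w, f' w = x - a z) := by
    intro x hx
    refine ⟨cohomMk_eq_zero_iff (hg' x hx), ?_⟩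
    constructor
    · rintro ⟨c, hc⟩
      obtain ⟨z, hz, rfl⟩ := cohomMk_surjective c
      exact ⟨z, hz, (cohomMk_eq_cohomMk_iff hx (hg z hz)).1 hc.symm⟩
    · rintro ⟨z, hz, hw⟩
      exact ⟨cohomMk f g z hz, ((cohomMk_eq_cohomMk_iff hx (hg z hz)).2 hw).symm⟩
  constructor
  · intro h x hx
    rw [← (key x hx).1, ← (key x hx).2]
    exact h _
  · intro h c
    obtain ⟨x, hx, rfl⟩ := cohomMk_surjective c
    rw [(key x hx).1, (key x hx).2]
    exact h x hx

end CohomologyOfPairs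

/-! The Čech complexes are mapping cones: the Čech cochains are pairs `(e, r)` of a cochain `e` on
`U₀` and a relative cochain `r`, with differential `(e, r) ↦ (dE e, s e + dR r)`. -/

section Cone

variable {E₀ R₀ E R G E' R' V V' W : Type u}
  [AddCommGroup E₀] [Module ℂ E₀] [AddCommGroup R₀] [Module ℂ R₀]
  [AddCommGroup E] [Module ℂ E] [AddCommGroup R] [Module ℂ R] [AddCommGroup G] [Module ℂ G]
  [AddCommGroup E'] [Module ℂ E'] [AddCommGroup R'] [Module ℂ R']
  [AddCommGroup V] [Module ℂ V] [AddCommGroup V'] [Module ℂ V']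
  [AddCommGroup W] [Module ℂ W]

theorem cone_exact_base {f : G →ₗ[ℂ] E × R} {g : E × R →ₗ[ℂ] W} {fE : E₀ →ₗ[ℂ] E}
    {gE : E →ₗ[ℂ] V} {fR : R →ₗ[ℂ] R'} {fR' : R₀ →ₗ[ℂ] R'} {gR : R' →ₗ[ℂ] V'} {s : E →ₗ[ℂ] R'}
    (hgs : ∀ e r, g (e, r) = 0 ↔ gE e = 0 ∧ s e + fR r = 0)
    (hR : ∀ x, (∃ y, fR' y = x) ↔ ∃ y, fR y = x) (hg hf hg' hf') :
    Function.Exact (cohomMap f g fE gE (LinearMap.fst ℂ E R) hg hf)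
      (cohomMap fE gE fR' gR s hg' hf') := by
  rw [cohomMap_exact_iff]
  intro x hx
  rw [hR]
  constructor
  · rintro ⟨y, hy⟩
    exact ⟨(x, -y), (hgs _ _).2 ⟨hx, by simp [hy]⟩, 0, by simp⟩
  · rintro ⟨⟨e, r⟩, hz, w, hw⟩
    obtain ⟨y, hy⟩ := (hR _).1 (hf' w)
    refine ⟨y - r, ?_⟩
    rw [map_sub, hy, hw, LinearMap.fst_apply, map_sub, sub_sub, ((hgs e r).1 hz).2, sub_zero]

theorem cone_exact_relative {fE : E₀ →ₗ[ℂ] E} {gE : E →ₗ[ℂ] V} {fE' : E →ₗ[ℂ] E'}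
    {fR : R →ₗ[ℂ] R'} {gR : R' →ₗ[ℂ] V'} {s : E →ₗ[ℂ] R'}
    {f : E × R →ₗ[ℂ] E' × R'} {g : E' × R' →ₗ[ℂ] W}
    (hE : ∀ e, fE' e = 0 → gE e = 0)
    (hfs : ∀ e r, f (e, r) = (fE' e, s e + fR r))
    (hE' : ∀ e, gE e = 0 → fE' e = 0) (hg hf hg' hf') :
    Function.Exact (cohomMap fE gE fR gR s hg hf)
      (cohomMap fR gR f g (LinearMap.inr ℂ E' R') hg' hf') := by
  rw [cohomMap_exact_iff]
  intro x hx
  constructor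
  · rintro ⟨⟨e, r⟩, h⟩
    rw [hfs, LinearMap.inr_apply, Prod.mk.injEq] at h
    exact ⟨e, hE e h.1, r, eq_sub_of_add_eq' h.2⟩
  · rintro ⟨e, he, r, hr⟩
    exact ⟨(e, r), by rw [hfs, hE' e he, hr, add_sub_cancel]; rfl⟩

theorem cone_exact_total {fE : E →ₗ[ℂ] E'} {gE : E' →ₗ[ℂ] V} {fR : R →ₗ[ℂ] R'}
    {gR : R' →ₗ[ℂ] V'} {s : E →ₗ[ℂ] R'} {f : E × R →ₗ[ℂ] E' × R'} {g : E' × R' →ₗ[ℂ] W}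
    (hfs : ∀ e r, f (e, r) = (fE e, s e + fR r)) (hgf : ∀ t, g (f t) = 0)
    (hgR : ∀ r, g (0, r) = 0 → gR r = 0) (hg hf hg' hf') :
    Function.Exact (cohomMap fR gR f g (LinearMap.inr ℂ E' R') hg hf)
      (cohomMap f g fE gE (LinearMap.fst ℂ E' R') hg' hf') := by
  rw [cohomMap_exact_iff]
  rintro ⟨e, r⟩ hx
  constructor
  · rintro ⟨y, hy⟩
    have h : (e, r) - f (y, 0) = (0, r - s y) := by
      rw [hfs, hy]
      simp
    exact ⟨r - s y, hgR _ (by rw [← h, map_sub, hx, hgf, sub_zero]), (y, 0), by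
      rw [LinearMap.inr_apply, ← h, sub_sub_cancel]⟩
  · rintro ⟨z, -, ⟨y, r'⟩, h⟩
    refine ⟨y, ?_⟩
    rw [hfs] at h
    simpa using congrArg Prod.fst h

end Cone

namespace DoubleFormSheaf

variable {X : Type u} [TopologicalSpace X] (F : DoubleFormSheaf X)

section CastLemmas

variable {U V : Opens X} {p q p' q' p'' q'' : ℤ}

theorem cast_self (hp : p = p) (hq : q = q) (x : F.E p q U) : F.cast U hp hq x = x := rfl

theorem cast_cast (hp : p = p') (hq : q = q') (hp' : p' = p'') (hq' : q' = q'') (x : F.E p q U) :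
    F.cast U hp' hq' (F.cast U hp hq x) = F.cast U (hp.trans hp') (hq.trans hq') x := by
  subst hp hq hp' hq'; rfl

theorem cast_eq_zero_iff (hp : p = p') (hq : q = q') (x : F.E p q U) :
    F.cast U hp hq x = 0 ↔ x = 0 := by
  subst hp hq; rfl

theorem del_cast (hp : p = p') (hq : q = q') (x : F.E p q U) :
    F.del p' q' U (F.cast U hp hq x) = F.cast U (by rw [hp]) hq (F.del p q U x) := by
  subst hp hq; rfl

theorem dbar_cast (hp : p = p') (hq : q = q') (x : F.E p q U) :
    F.dbar p' q' U (F.cast U hp hq x) = F.cast U hp (by rw [hq]) (F.dbar p q U x) := by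
  subst hp hq; rfl

theorem res_cast (h : U ≤ V) (hp : p = p') (hq : q = q') (x : F.E p q V) :
    F.res p' q' h (F.cast V hp hq x) = F.cast U hp hq (F.res p q h x) := by
  subst hp hq; rfl

theorem dbar_del (x : F.E p q U) :
    F.dbar (p + 1) q U (F.del p q U x) = -F.del p (q + 1) U (F.dbar p q U x) :=
  eq_neg_of_add_eq_zero_right (F.del_dbar p q U x)

end CastLemmas

variable (U₀ U₁ : Opens X) (p q : ℤ)

/-- The `U₀`-part `θ ↦ (0, -θ)` of the differential from Aeppli to Bott–Chern cochains. -/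
def connectBC : F.E (p - 1) (q - 1) U₀ →ₗ[ℂ] RBC F U₀ U₁ p q :=
  LinearMap.prod 0 (-(F.res (p - 1) (q - 1) inf_le_left))

/-- The `U₀`-part `θ ↦ (0, -θ)` of the differential from Bott–Chern cochains to cochains of the
third type. -/
def connectT : F.E p q U₀ →ₗ[ℂ] RT F U₀ U₁ p q :=
  LinearMap.prod 0 (-(F.res p q inf_le_left))

/-- The `U₀`-part `θ ↦ (0, -θ)` of the differential from cochains of the third type to Aeppli
cochains. -/
def connectA : (F.E (p + 1) q U₀ × F.E p (q + 1) U₀) →ₗ[ℂ] RA F U₀ U₁ (p + 1) (q + 1) :=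
  LinearMap.prod 0 (LinearMap.prod
    (-((F.cast _ rfl (show q = q + 1 - 1 by ring)).comp
      ((F.res (p + 1) q inf_le_left).comp qA)))
    (-((F.cast _ (show p = p + 1 - 1 by ring) rfl).comp
      ((F.res p (q + 1) inf_le_left).comp qB))))

/-- The differential from Čech–Aeppli cochains into `E^{p,q}_{BC}(𝒰)`. -/
abbrev inTBC : TA F U₀ U₁ (p - 1) (q - 1) →ₗ[ℂ] TBC F U₀ U₁ p q :=
  (castTBC F U₀ U₁ (show p - 1 + 1 = p by ring) (show q - 1 + 1 = q by ring)).comp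
    (DtoTBC F U₀ U₁ (p - 1) (q - 1))

/-- The differential from relative Aeppli cochains into `E^{p,q}_{BC}(𝒰, U₀)`. -/
abbrev inRBC : RA F U₀ U₁ (p - 1) (q - 1) →ₗ[ℂ] RBC F U₀ U₁ p q :=
  (castRBC F U₀ U₁ (show p - 1 + 1 = p by ring) (show q - 1 + 1 = q by ring)).comp
    (RtoTBC F U₀ U₁ (p - 1) (q - 1))

/-- The differential `∂̄∂ : E^{p-1,q-1}(U₀) → E^{p,q}(U₀)`. -/
abbrev inBC : F.E (p - 1) (q - 1) U₀ →ₗ[ℂ] F.E p q U₀ :=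
  (F.cast U₀ (show p - 1 + 1 = p by ring) (show q - 1 + 1 = q by ring)).comp
    (ddbarW F U₀ (p - 1) (q - 1))

theorem inTBC_apply (e : F.E (p - 1) (q - 1) U₀) (r : RA F U₀ U₁ (p - 1) (q - 1)) :
    inTBC F U₀ U₁ p q (e, r) =
      (inBC F U₀ p q e, connectBC F U₀ U₁ p q e + inRBC F U₀ U₁ p q r) := by
  obtain ⟨r₁, r₂, r₃⟩ := r
  simp [inTBC, inBC, inRBC, connectBC, castTBC, castRBC, DtoTBC, RtoTBC, ddbarW, lmTri, pA, pB,
    pC, qA, qB, cast_cast, cast_self]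
  abel

theorem DtoTT_apply (e : F.E p q U₀) (r : RBC F U₀ U₁ p q) :
    DtoTT F U₀ U₁ p q (e, r) =
      (dfullW F U₀ p q e, connectT F U₀ U₁ p q e + RtoTT F U₀ U₁ p q r) := by
  obtain ⟨r₁, r₂⟩ := r
  simp [connectT, DtoTT, RtoTT, dfullW, lmTri, pA, pB, pC, qA, qB]
  abel

theorem DtoTA_apply (e : F.E (p + 1) q U₀ × F.E p (q + 1) U₀) (r : RT F U₀ U₁ p q) :
    DtoTA F U₀ U₁ p q (e, r) =
      (plusTW F U₀ p q e, connectA F U₀ U₁ p q e + RtoTA F U₀ U₁ p q r) := by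
  obtain ⟨e₁, e₂⟩ := e
  obtain ⟨⟨r₁, r₂⟩, r₃⟩ := r
  simp [connectA, DtoTA, RtoTA, plusTW, lmTri, pA, pB, pC, qA, qB]
  constructor <;> abel

theorem inTBC_eq_zero_iff (t : TA F U₀ U₁ (p - 1) (q - 1)) :
    inTBC F U₀ U₁ p q t = 0 ↔ DtoTBC F U₀ U₁ (p - 1) (q - 1) t = 0 := by
  simp only [inTBC, LinearMap.comp_apply]
  generalize DtoTBC F U₀ U₁ (p - 1) (q - 1) t = s
  simp [castTBC, lmTri, pA, pB, pC, Prod.ext_iff, cast_eq_zero_iff]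

theorem inBC_eq_zero_iff (e : F.E (p - 1) (q - 1) U₀) :
    inBC F U₀ p q e = 0 ↔ ddbarW F U₀ (p - 1) (q - 1) e = 0 :=
  F.cast_eq_zero_iff _ _ _

theorem DtoTT_inTBC (t : TA F U₀ U₁ (p - 1) (q - 1)) :
    DtoTT F U₀ U₁ p q (inTBC F U₀ U₁ p q t) = 0 := by
  obtain ⟨t₀, t₁, t₂, t₃⟩ := t
  simp [inTBC, castTBC, DtoTBC, DtoTT, lmTri, pA, pB, pC, qA, qB, cast_cast, cast_self, del_cast,
    dbar_cast, res_cast, res_del, res_dbar, dbar_del, del_del, dbar_dbar]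

theorem DtoTA_DtoTT (t : TBC F U₀ U₁ p q) :
    DtoTA F U₀ U₁ p q (DtoTT F U₀ U₁ p q t) = 0 := by
  obtain ⟨t₀, t₁, t₂⟩ := t
  simp [DtoTA, DtoTT, lmTri, pA, pB, pC, qA, qB, del_cast, dbar_cast, res_del, res_dbar,
    dbar_del, del_del, dbar_dbar]

theorem DtoTBC_DtoTA (t : TT F U₀ U₁ p q) :
    DtoTBC F U₀ U₁ (p + 1) (q + 1) (DtoTA F U₀ U₁ p q t) = 0 := by
  obtain ⟨⟨t₀, t₁⟩, ⟨t₂, t₃⟩, t₄⟩ := t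
  simp [DtoTBC, DtoTA, lmTri, pA, pB, pC, qA, qB, cast_cast, cast_self, del_cast,
    dbar_cast, res_del, res_dbar, dbar_del, del_del, dbar_dbar]
  abel

theorem DtoTBC_inr (r : RA F U₀ U₁ p q) :
    DtoTBC F U₀ U₁ p q (0, r) = (0, RtoTBC F U₀ U₁ p q r) := by
  simp [DtoTBC, RtoTBC, lmTri, pA, pB, pC, qA, qB]

theorem DtoTT_inr (r : RBC F U₀ U₁ p q) :
    DtoTT F U₀ U₁ p q (0, r) = (0, RtoTT F U₀ U₁ p q r) := by
  simp only [DtoTT_apply, map_zero, zero_add]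

theorem DtoTA_inr (r : RT F U₀ U₁ p q) :
    DtoTA F U₀ U₁ p q (0, r) = (0, RtoTA F U₀ U₁ p q r) := by
  simp only [DtoTA_apply, map_zero, zero_add]

theorem inTBC_inr (r : RA F U₀ U₁ (p - 1) (q - 1)) :
    inTBC F U₀ U₁ p q (0, r) = (0, inRBC F U₀ U₁ p q r) := by
  simp only [inTBC_apply, map_zero, zero_add]

theorem DtoTBC_eq_zero_iff (e : F.E (p - 1) (q - 1) U₀) (r : RA F U₀ U₁ (p - 1) (q - 1)) :
    DtoTBC F U₀ U₁ (p - 1) (q - 1) (e, r) = 0 ↔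
      ddbarW F U₀ (p - 1) (q - 1) e = 0 ∧
        connectBC F U₀ U₁ p q e + inRBC F U₀ U₁ p q r = 0 := by
  rw [← inTBC_eq_zero_iff, inTBC_apply, Prod.mk_eq_zero, inBC_eq_zero_iff]

theorem DtoTT_eq_zero_iff (e : F.E p q U₀) (r : RBC F U₀ U₁ p q) :
    DtoTT F U₀ U₁ p q (e, r) = 0 ↔
      dfullW F U₀ p q e = 0 ∧ connectT F U₀ U₁ p q e + RtoTT F U₀ U₁ p q r = 0 := by
  rw [DtoTT_apply, Prod.mk_eq_zero]

theorem DtoTA_eq_zero_iff (e : F.E (p + 1) q U₀ × F.E p (q + 1) U₀) (r : RT F U₀ U₁ p q) :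
    DtoTA F U₀ U₁ p q (e, r) = 0 ↔
      plusTW F U₀ p q e = 0 ∧ connectA F U₀ U₁ p q e + RtoTA F U₀ U₁ p q r = 0 := by
  rw [DtoTA_apply, Prod.mk_eq_zero]

theorem exists_plusW_eq (t : TT F U₀ U₁ (p - 1) (q - 1)) :
    ∃ w, plusW F U₀ p q w =
      ((castTA F U₀ U₁ (show p - 1 + 1 = p by ring) (show q - 1 + 1 = q by ring)).comp
        (DtoTA F U₀ U₁ (p - 1) (q - 1)) t).1 := by
  obtain ⟨⟨t₀, t₁⟩, r⟩ := t
  refine ⟨(F.cast U₀ (by ring) rfl t₀, F.cast U₀ rfl (by ring) t₁), ?_⟩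
  simp [plusW, castTA, DtoTA, lmTri, pA, qA, qB, del_cast, dbar_cast, cast_cast]

theorem exists_inRBC_eq (w : F.E (p - 1) (q - 1 - 1) U₀ × F.E (p - 1 - 1) (q - 1) U₀) :
    ∃ r, inRBC F U₀ U₁ p q r = connectBC F U₀ U₁ p q (plusW F U₀ (p - 1) (q - 1) w) := by
  obtain ⟨w₁, w₂⟩ := w
  refine ⟨(0, F.res _ _ inf_le_left w₁, F.res _ _ inf_le_left w₂), ?_⟩
  simp [inRBC, castRBC, RtoTBC, connectBC, plusW, qA, qB, cast_cast, res_cast, res_del,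
    res_dbar]
  abel

theorem exists_castRA_RtoTA_iff {p' q' : ℤ} (hp : p' = p) (hq : q' = q)
    (x : RA F U₀ U₁ (p + 1) (q + 1)) :
    (∃ r, (castRA F U₀ U₁ (show p' + 1 = p + 1 by rw [hp]) (show q' + 1 = q + 1 by rw [hq])).comp
      (RtoTA F U₀ U₁ p' q') r = x) ↔ ∃ r, RtoTA F U₀ U₁ p q r = x := by
  subst hp hq
  exact Iff.rfl

theorem RtoTT_connectBC {e : F.E (p - 1) (q - 1) U₀} (he : ddbarW F U₀ (p - 1) (q - 1) e = 0) :
    RtoTT F U₀ U₁ p q (connectBC F U₀ U₁ p q e) = 0 := by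
  have h := DtoTT_inTBC F U₀ U₁ p q (e, 0)
  rw [inTBC_apply, (inBC_eq_zero_iff F U₀ p q e).2 he, map_zero, add_zero, DtoTT_inr] at h
  exact congrArg Prod.snd h

theorem RtoTA_connectT {e : F.E p q U₀} (he : dfullW F U₀ p q e = 0) :
    RtoTA F U₀ U₁ p q (connectT F U₀ U₁ p q e) = 0 := by
  have h := DtoTA_DtoTT F U₀ U₁ p q (e, 0)
  rw [DtoTT_apply, he, map_zero, add_zero, DtoTA_inr] at h
  exact congrArg Prod.snd h

theorem RtoTBC_connectA {e : F.E (p + 1) q U₀ × F.E p (q + 1) U₀} (he : plusTW F U₀ p q e = 0) :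
    RtoTBC F U₀ U₁ (p + 1) (q + 1) (connectA F U₀ U₁ p q e) = 0 := by
  have h := DtoTBC_DtoTA F U₀ U₁ p q (e, 0)
  rw [DtoTA_apply, he, map_zero, add_zero, DtoTBC_inr] at h
  exact congrArg Prod.snd h

theorem exists_RtoTT_eq (w : F.E (p - 1) (q - 1) U₀) :
    ∃ r, RtoTT F U₀ U₁ p q r = connectT F U₀ U₁ p q (inBC F U₀ p q w) := by
  have h := DtoTT_inTBC F U₀ U₁ p q (w, 0)
  rw [inTBC_apply, map_zero, add_zero, DtoTT_eq_zero_iff] at h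
  exact ⟨-connectBC F U₀ U₁ p q w, by rw [map_neg, eq_neg_of_add_eq_zero_left h.2]⟩

theorem exists_RtoTA_eq (w : F.E p q U₀) :
    ∃ r, RtoTA F U₀ U₁ p q r = connectA F U₀ U₁ p q (dfullW F U₀ p q w) := by
  have h := DtoTA_DtoTT F U₀ U₁ p q (w, 0)
  rw [DtoTT_apply, map_zero, add_zero, DtoTA_eq_zero_iff] at h
  exact ⟨-connectT F U₀ U₁ p q w, by rw [map_neg, eq_neg_of_add_eq_zero_left h.2]⟩

theorem fst_eq_zero_of_DtoTBC {t : TA F U₀ U₁ p q} (ht : DtoTBC F U₀ U₁ p q t = 0) :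
    ddbarW F U₀ p q t.1 = 0 :=
  congrArg Prod.fst ht

theorem fst_eq_zero_of_DtoTT {t : TBC F U₀ U₁ p q} (ht : DtoTT F U₀ U₁ p q t = 0) :
    dfullW F U₀ p q t.1 = 0 :=
  congrArg Prod.fst ht

theorem fst_eq_zero_of_DtoTA {t : TT F U₀ U₁ p q} (ht : DtoTA F U₀ U₁ p q t = 0) :
    plusTW F U₀ p q t.1 = 0 :=
  congrArg Prod.fst ht

end DoubleFormSheaf

/-- Theorem 3.12 of the paper: the long exact sequence relating the
Čech–Aeppli, relative and Čech–Bott–Chern, and third cohomologies. -/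
theorem statement7 {X : Type u} [TopologicalSpace X] (F : DoubleFormSheaf X)
    (S : Set X) (hS : IsClosed S) (U₁ : Opens X) (hU₁ : S ⊆ U₁) :
    letI U₀ : Opens X := ⟨Sᶜ, hS.isOpen_compl⟩
    ∀ p q : ℤ,
    ∃ (aI : HAcech F U₀ U₁ (p - 1) (q - 1) →ₗ[ℂ] HAopen F U₀ (p - 1) (q - 1))
      (δBC : HAopen F U₀ (p - 1) (q - 1) →ₗ[ℂ] HBCrel F U₀ U₁ p q)
      (bJ : HBCrel F U₀ U₁ p q →ₗ[ℂ] HBCcech F U₀ U₁ p q)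
      (bI : HBCcech F U₀ U₁ p q →ₗ[ℂ] HBCopen F U₀ p q)
      (δT : HBCopen F U₀ p q →ₗ[ℂ] HTrel F U₀ U₁ p q)
      (tJ : HTrel F U₀ U₁ p q →ₗ[ℂ] HTcech F U₀ U₁ p q)
      (tI : HTcech F U₀ U₁ p q →ₗ[ℂ] HTopen F U₀ p q)
      (δA : HTopen F U₀ p q →ₗ[ℂ] HArel F U₀ U₁ (p + 1) (q + 1)),
      -- `H^{p-1,q-1}_A(𝒰) → H^{p-1,q-1}_A(U₀)` is induced by `ξ ↦ ξ₀`
      (∀ (ξ : TA F U₀ U₁ (p - 1) (q - 1)) (hξ : DtoTBC F U₀ U₁ (p - 1) (q - 1) ξ = 0),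
        ∃ h', aI (cohomMk _ (DtoTBC F U₀ U₁ (p - 1) (q - 1)) ξ hξ)
          = cohomMk _ (ddbarW F U₀ (p - 1) (q - 1)) ξ.1 h') ∧
      -- `δ* : H^{p-1,q-1}_A(U₀) → H^{p,q}_{BC}(𝒰,U₀)`, `[θ] ↦ [(0, -θ)]`
      (∀ (θ : ↥(F.E (p - 1) (q - 1) U₀)) (hθ : ddbarW F U₀ (p - 1) (q - 1) θ = 0),
        ∃ h', δBC (cohomMk _ (ddbarW F U₀ (p - 1) (q - 1)) θ hθ)
          = cohomMk _ (RtoTT F U₀ U₁ p q)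
              ((0 : ↥(F.E p q U₁)), -(F.res (p - 1) (q - 1) inf_le_left θ)) h') ∧
      -- `j* : H^{p,q}_{BC}(𝒰,U₀) → H^{p,q}_{BC}(𝒰)`, `[(σ₁, σ₀₁)] ↦ [(0, σ₁, σ₀₁)]`
      (∀ (σ : RBC F U₀ U₁ p q) (hσ : RtoTT F U₀ U₁ p q σ = 0),
        ∃ h', bJ (cohomMk _ (RtoTT F U₀ U₁ p q) σ hσ)
          = cohomMk _ (DtoTT F U₀ U₁ p q) ((0 : ↥(F.E p q U₀)), σ.1, σ.2) h') ∧
      -- `i* : H^{p,q}_{BC}(𝒰) → H^{p,q}_{BC}(U₀)`, `[(σ₀, σ₁, σ₀₁)] ↦ [σ₀]`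
      (∀ (σ : TBC F U₀ U₁ p q) (hσ : DtoTT F U₀ U₁ p q σ = 0),
        ∃ h', bI (cohomMk _ (DtoTT F U₀ U₁ p q) σ hσ)
          = cohomMk _ (dfullW F U₀ p q) σ.1 h') ∧
      -- `δ : H^{p,q}_{BC}(U₀) → H^{(p,q)+1}(𝒰,U₀)`, `[θ] ↦ [(0, -θ)]`
      (∀ (θ : ↥(F.E p q U₀)) (hθ : dfullW F U₀ p q θ = 0),
        ∃ h', δT (cohomMk _ (dfullW F U₀ p q) θ hθ)
          = cohomMk _ (RtoTA F U₀ U₁ p q)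
              (((0, 0) : ↥(F.E (p + 1) q U₁) × ↥(F.E p (q + 1) U₁)),
                -(F.res p q inf_le_left θ)) h') ∧
      -- `j : H^{(p,q)+1}(𝒰,U₀) → H^{(p,q)+1}(𝒰)`
      (∀ (σ : RT F U₀ U₁ p q) (hσ : RtoTA F U₀ U₁ p q σ = 0),
        ∃ h', tJ (cohomMk _ (RtoTA F U₀ U₁ p q) σ hσ)
          = cohomMk _ (DtoTA F U₀ U₁ p q)
              (((0, 0) : ↥(F.E (p + 1) q U₀) × ↥(F.E p (q + 1) U₀)), σ.1, σ.2) h') ∧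
      -- `i : H^{(p,q)+1}(𝒰) → H^{(p,q)+1}(U₀)`
      (∀ (σ : TT F U₀ U₁ p q) (hσ : DtoTA F U₀ U₁ p q σ = 0),
        ∃ h', tI (cohomMk _ (DtoTA F U₀ U₁ p q) σ hσ)
          = cohomMk _ (plusTW F U₀ p q) σ.1 h') ∧
      -- `δ : H^{(p,q)+1}(U₀) → H^{p+1,q+1}_A(𝒰,U₀)`, `[θ] ↦ [(0, -θ)]`
      (∀ (θ : ↥(F.E (p + 1) q U₀) × ↥(F.E p (q + 1) U₀)) (hθ : plusTW F U₀ p q θ = 0),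
        ∃ h', δA (cohomMk _ (plusTW F U₀ p q) θ hθ)
          = cohomMk _ (RtoTBC F U₀ U₁ (p + 1) (q + 1))
              ((0 : ↥(F.E (p + 1) (q + 1) U₁)),
                (-(F.cast _ rfl (show q = q + 1 - 1 by ring)
                    (F.res (p + 1) q inf_le_left θ.1)),
                  -(F.cast _ (show p = p + 1 - 1 by ring) rfl
                    (F.res p (q + 1) inf_le_left θ.2)))) h') ∧
      -- exactness at the seven interior spots of the displayed sequence
      Function.Exact ⇑aI ⇑δBC ∧ Function.Exact ⇑δBC ⇑bJ ∧ Function.Exact ⇑bJ ⇑bI ∧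
      Function.Exact ⇑bI ⇑δT ∧ Function.Exact ⇑δT ⇑tJ ∧ Function.Exact ⇑tJ ⇑tI ∧
      Function.Exact ⇑tI ⇑δA := by
  intro p q
  let U₀ : Opens X := ⟨Sᶜ, hS.isOpen_compl⟩
  refine ⟨
    cohomMap _ _ _ _ (LinearMap.fst ℂ _ _)
      (fun _ h => fst_eq_zero_of_DtoTBC F U₀ U₁ _ _ h)
      (exists_plusW_eq F U₀ U₁ (p - 1) (q - 1)),
    cohomMap _ _ _ _ (connectBC F U₀ U₁ p q)
      (fun _ h => RtoTT_connectBC F U₀ U₁ p q h)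
      (exists_inRBC_eq F U₀ U₁ p q),
    cohomMap _ _ _ _ (LinearMap.inr ℂ _ _)
      (fun r h => by rw [LinearMap.inr_apply, DtoTT_inr, h]; rfl)
      (fun r => ⟨(0, r), inTBC_inr F U₀ U₁ p q r⟩),
    cohomMap _ _ _ _ (LinearMap.fst ℂ _ _)
      (fun _ h => fst_eq_zero_of_DtoTT F U₀ U₁ _ _ h)
      (fun t => ⟨t.1, (congrArg Prod.fst (inTBC_apply F U₀ U₁ p q t.1 t.2)).symm⟩),
    cohomMap _ _ _ _ (connectT F U₀ U₁ p q)
      (fun _ h => RtoTA_connectT F U₀ U₁ p q h)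
      (exists_RtoTT_eq F U₀ U₁ p q),
    cohomMap _ _ _ _ (LinearMap.inr ℂ _ _)
      (fun r h => by rw [LinearMap.inr_apply, DtoTA_inr, h]; rfl)
      (fun r => ⟨(0, r), DtoTT_inr F U₀ U₁ p q r⟩),
    cohomMap _ _ _ _ (LinearMap.fst ℂ _ _)
      (fun _ h => fst_eq_zero_of_DtoTA F U₀ U₁ _ _ h)
      (fun t => ⟨t.1, (congrArg Prod.fst (DtoTT_apply F U₀ U₁ p q t.1 t.2)).symm⟩),
    cohomMap _ _ _ _ (connectA F U₀ U₁ p q)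
      (fun _ h => RtoTBC_connectA F U₀ U₁ p q h)
      (fun w => (exists_castRA_RtoTA_iff F U₀ U₁ p q (by ring) (by ring) _).2
        (exists_RtoTA_eq F U₀ U₁ p q w)),
    fun ξ hξ => ⟨fst_eq_zero_of_DtoTBC F U₀ U₁ _ _ hξ, rfl⟩,
    fun θ hθ => ⟨RtoTT_connectBC F U₀ U₁ p q hθ, rfl⟩,
    fun σ hσ => ⟨by rw [DtoTT_inr, hσ]; rfl, rfl⟩,
    fun σ hσ => ⟨fst_eq_zero_of_DtoTT F U₀ U₁ _ _ hσ, rfl⟩,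
    fun θ hθ => ⟨RtoTA_connectT F U₀ U₁ p q hθ, rfl⟩,
    fun σ hσ => ⟨(DtoTA_inr F U₀ U₁ p q σ).trans (by rw [hσ]; rfl), rfl⟩,
    fun σ hσ => ⟨fst_eq_zero_of_DtoTA F U₀ U₁ _ _ hσ, rfl⟩,
    fun θ hθ => ⟨RtoTBC_connectA F U₀ U₁ p q hθ, rfl⟩,
    cone_exact_base (DtoTBC_eq_zero_iff F U₀ U₁ p q) (fun _ => Iff.rfl) _ _ _ _,
    cone_exact_relative (fun e => (inBC_eq_zero_iff F U₀ p q e).1) (inTBC_apply F U₀ U₁ p q)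
      (fun e => (inBC_eq_zero_iff F U₀ p q e).2) _ _ _ _,
    cone_exact_total (inTBC_apply F U₀ U₁ p q) (DtoTT_inTBC F U₀ U₁ p q)
      (fun r h => congrArg Prod.snd ((DtoTT_inr F U₀ U₁ p q r).symm.trans h)) _ _ _ _,
    cone_exact_base (DtoTT_eq_zero_iff F U₀ U₁ p q) (fun _ => Iff.rfl) _ _ _ _,
    cone_exact_relative (fun _ h => h) (DtoTT_apply F U₀ U₁ p q) (fun _ h => h) _ _ _ _,
    cone_exact_total (DtoTT_apply F U₀ U₁ p q) (DtoTA_DtoTT F U₀ U₁ p q)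
      (fun r h => congrArg Prod.snd ((DtoTA_inr F U₀ U₁ p q r).symm.trans h)) _ _ _ _,
    cone_exact_base (DtoTA_eq_zero_iff F U₀ U₁ p q)
      (exists_castRA_RtoTA_iff F U₀ U₁ p q (by ring) (by ring)) _ _ _ _⟩
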